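/- Let X be a separable real normed vector space and let g : X → ℝ ∪ {+∞} be a proper lower semicontinuous sublinear function. Then the quasi-relative interior of ∂g(0), taken in X* with the weak* topology, is nonempty; consequently there exists x* ∈ X* such that the set {x ∈ X : g(x) ≤ ⟨x, x*⟩} is a linear subspace of X. -/

import Mathlib

open Filter Topology Set Pointwise TopologicalSpace

noncomputable section

section Defs

variable {E : Type*} [AddCommGroup E] [Module ℝ E]

/-- Recession function of `f` based at `x₀ ∈ dom f`, as the supremum of the
(nondecreasing) difference quotients `(f (x₀ + t • u) - f x₀) / t`, `t > 0`. -/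
def recAt (f : E → EReal) (x₀ u : E) : EReal :=
  ⨆ t ∈ Set.Ioi (0 : ℝ), ((t⁻¹ : ℝ) : EReal) * (f (x₀ + t • u) - f x₀)

/-- Sublinear function: positively homogeneous and subadditive. -/
def SublinearFn (g : E → EReal) : Prop :=
  g 0 = 0 ∧ (∀ x : E, ∀ t : ℝ, 0 < t → g (t • x) = (t : EReal) * g x) ∧
    ∀ x y : E, g (x + y) ≤ g x + g y

variable [TopologicalSpace E]

/-- `Γ(E)`: proper lower semicontinuous convex functions. -/
def GammaFn (f : E → EReal) : Prop :=
  (∃ x, f x ≠ ⊤) ∧ (∀ x, f x ≠ ⊥) ∧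
    Convex ℝ {p : E × ℝ | f p.1 ≤ (p.2 : EReal)} ∧ LowerSemicontinuous f

/-- Subdifferential at `0`, as a subset of the weak* dual. -/
def subdiff0 (g : E → EReal) : Set (WeakDual ℝ E) :=
  {xs | ∀ x, (xs x : EReal) ≤ g x}

/-- Fenchel conjugate. -/
def conjFn (f : E → EReal) (xs : WeakDual ℝ E) : EReal :=
  ⨆ x, ((xs x : EReal) - f x)

/-- Domain of the conjugate. -/
def domConj (f : E → EReal) : Set (WeakDual ℝ E) := {xs | conjFn f xs ≠ ⊤}

/-- `xs ∈ ∂f(x)`. -/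
def inSubdiff (f : E → EReal) (xs : WeakDual ℝ E) (x : E) : Prop :=
  f x ≠ ⊤ ∧ f x ≠ ⊥ ∧ ∀ x' : E, ((xs x' - xs x : ℝ) : EReal) + f x ≤ f x'

/-- Directionally coercive function. -/
def DirCoercive (f : E → EReal) : Prop :=
  ∀ x : E, ∀ u : E, u ≠ 0 → Filter.Tendsto (fun t : ℝ => f (x + t • u)) Filter.atTop (nhds ⊤)

/-- The set `L_{x*} = {x | g(x) = ⟨x, x*⟩ and g(-x) = -⟨x, x*⟩}`. -/
def LxSet (g : E → EReal) (xs : WeakDual ℝ E) : Set E :=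
  {x | g x = (xs x : EReal) ∧ g (-x) = ((-(xs x) : ℝ) : EReal)}

end Defs

section QRI

variable {F : Type*} [AddCommGroup F] [Module ℝ F] [TopologicalSpace F]

/-- The cone `ℝ₊ (A - a)`. -/
def coneGen (A : Set F) (a : F) : Set F :=
  {x | ∃ t : ℝ, 0 ≤ t ∧ ∃ b ∈ A, x = t • (b - a)}

/-- Quasi-relative interior. -/
def qri (A : Set F) : Set F :=
  {a ∈ A | ∃ S : Submodule ℝ F, closure (coneGen A a) = (S : Set F)}

/-- Quasi-interior. -/
def qi (A : Set F) : Set F :=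
  {a ∈ A | closure (coneGen A a) = Set.univ}

/-- Algebraic core of a set. -/
def coreSet (A : Set F) : Set F :=
  {a : F | ∀ u : F, ∃ δ : ℝ, 0 < δ ∧ ∀ t ∈ Set.Icc (0 : ℝ) δ, a + t • u ∈ A}

end QRI

variable {X : Type*}

section Auxiliary

variable {E : Type*} [AddCommGroup E] [Module ℝ E]

lemma smul_mem_coneGen {A : Set E} {a x : E} (hx : x ∈ coneGen A a) {s : ℝ} (hs : 0 ≤ s) :
    s • x ∈ coneGen A a := by
  obtain ⟨t, ht, b, hb, rfl⟩ := hx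
  exact ⟨s * t, mul_nonneg hs ht, b, hb, smul_smul _ _ _⟩

lemma add_mem_coneGen {A : Set E} (hA : Convex ℝ A) {a x y : E} (hx : x ∈ coneGen A a)
    (hy : y ∈ coneGen A a) : x + y ∈ coneGen A a := by
  obtain ⟨t, ht, b, hb, rfl⟩ := hx
  obtain ⟨s, hs, c, hc, rfl⟩ := hy
  rcases (add_nonneg ht hs).eq_or_lt with h0 | h0
  · have ht0 : t = 0 := by linarith
    have hs0 : s = 0 := by linarith
    exact ⟨0, le_rfl, b, hb, by simp [ht0, hs0]⟩
  · refine ⟨t + s, h0.le, (t / (t + s)) • b + (s / (t + s)) • c,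
      hA hb hc (by positivity) (by positivity) (by field_simp), ?_⟩
    rw [smul_sub (t + s), smul_add, smul_smul, smul_smul, mul_div_cancel₀ _ h0.ne',
      mul_div_cancel₀ _ h0.ne']
    module

lemma convex_coneGen {A : Set E} (hA : Convex ℝ A) (a : E) : Convex ℝ (coneGen A a) :=
  fun _ hx _ hy _ _ hs ht _ =>
    add_mem_coneGen hA (smul_mem_coneGen hx hs) (smul_mem_coneGen hy ht)

end Auxiliary

/-- Any sequence in a Banach space has a convergent infinite convex combination with strictly
positive weights. -/
lemma exists_pos_hasSum_one_summable_smul {E : Type*} [NormedAddCommGroup E] [NormedSpace ℝ E]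
    [CompleteSpace E] (d : ℕ → E) :
    ∃ μ : ℕ → ℝ, (∀ n, 0 < μ n) ∧ HasSum μ 1 ∧ Summable fun n => μ n • d n := by
  have hpos : ∀ n, 0 < (1 / 2 : ℝ) ^ n / (1 + ‖d n‖) := fun n => by positivity
  have hle : ∀ n, (1 / 2 : ℝ) ^ n / (1 + ‖d n‖) ≤ (1 / 2) ^ n := fun n =>
    div_le_self (by positivity) (by linarith [norm_nonneg (d n)])
  have hs : Summable fun n => (1 / 2 : ℝ) ^ n / (1 + ‖d n‖) :=
    summable_geometric_two.of_nonneg_of_le (fun n => (hpos n).le) hle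
  have hd : Summable fun n => ((1 / 2 : ℝ) ^ n / (1 + ‖d n‖)) • d n := by
    refine summable_geometric_two.of_norm_bounded fun n => ?_
    rw [norm_smul, Real.norm_of_nonneg (hpos n).le, div_mul_eq_mul_div]
    exact (div_le_iff₀ (by positivity)).2
      (mul_le_mul_of_nonneg_left (by linarith) (by positivity))
  have hZ := hs.tsum_pos (fun n => (hpos n).le) 0 (hpos 0)
  refine ⟨_, fun n => mul_pos (inv_pos.2 hZ) (hpos n), ?_, ?_⟩
  · have := hs.hasSum.mul_left (∑' n, (1 / 2 : ℝ) ^ n / (1 + ‖d n‖))⁻¹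
    rwa [inv_mul_cancel₀ hZ.ne'] at this
  · simpa only [mul_smul] using hd.const_smul (∑' n, (1 / 2 : ℝ) ^ n / (1 + ‖d n‖))⁻¹

section Normed

variable [NormedAddCommGroup X] [NormedSpace ℝ X]

/-- A nonempty weak* closed subset of the dual of a separable space is weak* separable. -/
lemma exists_seq_dense_of_isClosed_weakDual [SeparableSpace X] {C : Set (WeakDual ℝ X)}
    (hC : IsClosed C) (hne : C.Nonempty) :
    ∃ d : ℕ → WeakDual ℝ X, (∀ n, d n ∈ C) ∧ C ⊆ closure (range d) := by
  obtain ⟨c₀, hc₀⟩ := hne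
  let K : ℕ → Set (WeakDual ℝ X) := fun n =>
    C ∩ WeakDual.toStrongDual ⁻¹' Metric.closedBall (WeakDual.toStrongDual c₀) n
  have hK : ∀ n, IsCompact (K n) := fun n =>
    (WeakDual.isCompact_closedBall _ _).inter_left hC
  have hd : ∀ n, ∃ d : ℕ → K n, DenseRange d := fun n => by
    have := WeakDual.metrizable_of_isCompact ℝ X (K n) (hK n)
    have := isCompact_iff_compactSpace.1 (hK n)
    let _ := metrizableSpaceMetric (K n)
    have : Nonempty (K n) := ⟨⟨c₀, hc₀, by simp⟩⟩
    exact exists_dense_seq _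
  choose d hd using hd
  refine ⟨fun k => d k.unpair.1 k.unpair.2, fun k => (d _ _).2.1, fun c hc => ?_⟩
  obtain ⟨n, hn⟩ := exists_nat_ge (dist (WeakDual.toStrongDual c) (WeakDual.toStrongDual c₀))
  have h1 := image_closure_subset_closure_image (continuous_subtype_val (p := (· ∈ K n)))
    ⟨⟨c, hc, hn⟩, hd n _, rfl⟩
  refine closure_mono ?_ h1
  rintro _ ⟨_, ⟨m, rfl⟩, rfl⟩
  exact ⟨Nat.pair n m, congrArg (fun p : ℕ × ℕ => (d p.1 p.2).1) (Nat.unpair_pair n m)⟩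

/-- For a nonempty weak* closed set `C` in the dual of a separable space there is a point `a` of its
closed convex hull such that any `x` whose maximum over `C` is at most `a x` is constant on `C`. -/
lemma exists_forall_le_imp_eq [SeparableSpace X] {C : Set (WeakDual ℝ X)}
    (hC : IsClosed C) (hne : C.Nonempty) :
    ∃ a : WeakDual ℝ X, (∀ (x : X) (r : ℝ), (∀ c ∈ C, c x ≤ r) → a x ≤ r) ∧
      ∀ x : X, (∀ c ∈ C, c x ≤ a x) → ∀ c ∈ C, c x = a x := by
  obtain ⟨d, hdC, hd⟩ := exists_seq_dense_of_isClosed_weakDual hC hne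
  obtain ⟨μ, hμ, hμ1, hs⟩ :=
    exists_pos_hasSum_one_summable_smul fun n => WeakDual.toStrongDual (d n)
  let a : StrongDual ℝ X := ∑' n, μ n • WeakDual.toStrongDual (d n)
  have ha : ∀ x, HasSum (fun n => μ n * d n x) (a x) := fun x =>
    hs.hasSum.mapL (ContinuousLinearMap.apply ℝ ℝ x)
  refine ⟨StrongDual.toWeakDual a, fun x r h => ?_, fun x h c hc => ?_⟩
  · have h1 := hμ1.mul_right r
    rw [one_mul] at h1
    exact hasSum_le (fun n => mul_le_mul_of_nonneg_left (h _ (hdC n)) (hμ n).le) (ha x) h1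
  · have h1 := (hμ1.mul_right (a x)).sub (ha x)
    rw [one_mul, sub_self] at h1
    have h2 := (hasSum_zero_iff_of_nonneg fun n =>
      sub_nonneg.2 (mul_le_mul_of_nonneg_left (h _ (hdC n)) (hμ n).le)).1 h1
    have h3 : ∀ n, d n x = a x := fun n =>
      (mul_left_cancel₀ (hμ n).ne' (sub_eq_zero.1 (congrFun h2 n))).symm
    have h4 : IsClosed {c : WeakDual ℝ X | c x = a x} :=
      isClosed_eq (WeakDual.eval_continuous x) continuous_const
    exact closure_minimal (range_subset_iff.2 h3) h4 (hd hc)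

lemma mem_qri_of_forall_le_imp_eq {C : Set (WeakDual ℝ X)} (hC : Convex ℝ C) {a : WeakDual ℝ X}
    (ha : a ∈ C) (h : ∀ x : X, (∀ c ∈ C, c x ≤ a x) → ∀ c ∈ C, c x = a x) : a ∈ qri C := by
  let S : Submodule ℝ (WeakDual ℝ X) :=
    { carrier := {y | ∀ x : X, (∀ c ∈ C, c x = a x) → y x = 0}
      add_mem' := fun {y z} hy hz x hx => by
        change y x + z x = 0
        rw [hy x hx, hz x hx, add_zero]
      zero_mem' := fun x _ => rfl
      smul_mem' := fun t y hy x hx => by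
        change t * y x = 0
        rw [hy x hx, mul_zero] }
  refine ⟨ha, S, Subset.antisymm (closure_minimal ?_ ?_) fun y hy => ?_⟩
  · rintro _ ⟨t, -, b, hb, rfl⟩ x hx
    change t * (b x - a x) = 0
    rw [hx b hb, sub_self, mul_zero]
  · have : (S : Set (WeakDual ℝ X)) = ⋂ (x : X) (_ : ∀ c ∈ C, c x = a x), {y | y x = 0} := by
      ext y
      simp only [mem_iInter]
      rfl
    rw [this]
    exact isClosed_iInter fun x => isClosed_iInter fun _ =>
      isClosed_eq (WeakDual.eval_continuous x) continuous_const
  · by_contra hyK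
    have : LocallyConvexSpace ℝ (WeakDual ℝ X) :=
      WeakBilin.locallyConvexSpace (B := topDualPairing ℝ X)
    have : ContinuousSMul ℝ (WeakDual ℝ X) :=
      WeakBilin.instContinuousSMul (topDualPairing ℝ X)
    obtain ⟨f, u, hf, hu⟩ :=
      geometric_hahn_banach_closed_point (convex_coneGen hC a).closure isClosed_closure hyK
    obtain ⟨x, hx⟩ := LinearMap.dualEmbedding_surjective (topDualPairing ℝ X) f
    have hfx : ∀ z : WeakDual ℝ X, f z = z x := fun z => by rw [← hx]; rfl
    have hu0 : 0 < u := by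
      simpa using hf 0 (subset_closure ⟨0, le_rfl, a, ha, by simp⟩)
    have hle : ∀ c ∈ C, c x ≤ a x := fun c hc => by
      by_contra! hlt
      have h1 := hf _ (subset_closure ⟨u / (c x - a x),
        div_nonneg hu0.le (sub_nonneg.2 hlt.le), c, hc, rfl⟩)
      rw [map_smul, map_sub, hfx, hfx, smul_eq_mul, div_mul_cancel₀ _ (sub_pos.2 hlt).ne'] at h1
      exact h1.false
    have h2 := hy x (h x hle)
    rw [hfx, h2] at hu
    linarith

end Normed

section Sublinear

variable [NormedAddCommGroup X] [NormedSpace ℝ X] {g : X → EReal}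

lemma isClosed_subdiff0 (g : X → EReal) : IsClosed (subdiff0 g) := by
  have : subdiff0 g = ⋂ x, {c : WeakDual ℝ X | ((c x : ℝ) : EReal) ≤ g x} := by
    ext c
    simp [subdiff0]
  rw [this]
  exact isClosed_iInter fun x => isClosed_le
    (continuous_coe_real_ereal.comp (WeakDual.eval_continuous x)) continuous_const

lemma mem_subdiff0_iff (hproper : ∀ x, g x ≠ ⊥) {c : WeakDual ℝ X} :
    c ∈ subdiff0 g ↔ ∀ (x : X) (r : ℝ), g x ≤ r → c x ≤ r := by
  refine ⟨fun h x r hr => EReal.coe_le_coe_iff.1 ((h x).trans hr), fun h x => ?_⟩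
  rcases eq_or_ne (g x) ⊤ with hx | hx
  · rw [hx]; exact le_top
  · rw [← EReal.coe_toReal hx (hproper x)]
    exact EReal.coe_le_coe_iff.2 (h x _ (EReal.coe_toReal hx (hproper x)).ge)

lemma convex_subdiff0 (hproper : ∀ x, g x ≠ ⊥) : Convex ℝ (subdiff0 g) := by
  intro b hb c hc s t hs ht hst
  rw [mem_subdiff0_iff hproper] at *
  intro x r hr
  change s * b x + t * c x ≤ r
  calc s * b x + t * c x ≤ s * r + t * r := by
        gcongr
        exacts [hb x r hr, hc x r hr]
    _ = r := by rw [← add_mul, hst, one_mul]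

namespace SublinearFn

lemma smul_le (hsub : SublinearFn g) {x : X} {r t : ℝ} (ht : 0 ≤ t) (h : g x ≤ r) :
    g (t • x) ≤ ((t * r : ℝ) : EReal) := by
  rcases ht.eq_or_lt with rfl | ht
  · simp [hsub.1]
  · rw [hsub.2.1 x t ht, EReal.coe_mul]
    exact mul_le_mul_of_nonneg_left h (EReal.coe_nonneg.2 ht.le)

lemma add_le (hsub : SublinearFn g) {x y : X} {r s : ℝ} (hx : g x ≤ r) (hy : g y ≤ s) :
    g (x + y) ≤ ((r + s : ℝ) : EReal) := by
  rw [EReal.coe_add]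
  exact (hsub.2.2 x y).trans (add_le_add hx hy)

/-- Separation of a point from the epigraph, which is a closed convex cone. -/
lemma exists_separation (hsub : SublinearFn g) (hlsc : LowerSemicontinuous g) {x₀ : X} {r₀ : ℝ}
    (h : (r₀ : EReal) < g x₀) :
    ∃ (φ : StrongDual ℝ X) (s : ℝ), 0 ≤ s ∧ (∀ (x : X) (r : ℝ), g x ≤ r → φ x ≤ s * r) ∧
      s * r₀ < φ x₀ := by
  let K : Set (X × ℝ) := {p | g p.1 ≤ (p.2 : EReal)}
  have hKconv : Convex ℝ K := fun p hp q hq s t hs ht _ =>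
    hsub.add_le (hsub.smul_le hs hp) (hsub.smul_le ht hq)
  have hKclosed : IsClosed K := by
    have h1 := (hlsc.isClosed_epigraph).preimage
      (continuous_id.prodMap continuous_coe_real_ereal : Continuous fun p : X × ℝ => _)
    exact h1
  obtain ⟨f, u, hf, hu⟩ :=
    geometric_hahn_banach_closed_point hKconv hKclosed (x := (x₀, r₀)) (not_le.2 h)
  have hu0 : 0 < u := by simpa using hf 0 (by simp [K, hsub.1])
  have hf0 : ∀ p ∈ K, f p ≤ 0 := fun p hp => by
    by_contra! hlt
    have h1 := hf ((u / f p) • p) (hsub.smul_le (div_nonneg hu0.le hlt.le) hp)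
    rw [map_smul, smul_eq_mul, div_mul_cancel₀ _ hlt.ne'] at h1
    exact h1.false
  have hsplit : ∀ (x : X) (r : ℝ), f (x, r) = f (x, 0) + r * f (0, 1) := fun x r => by
    rw [← smul_eq_mul, ← map_smul, ← map_add]
    simp
  refine ⟨f.comp (ContinuousLinearMap.inl ℝ X ℝ), -f (0, 1), ?_, fun x r hr => ?_, ?_⟩
  · exact neg_nonneg.2 (hf0 _ (by simp [K, hsub.1]))
  · have h1 := hf0 (x, r) hr
    rw [hsplit] at h1
    change f (x, 0) ≤ _
    linarith
  · have h1 := hu0.trans hu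
    rw [hsplit] at h1
    change _ < f (x₀, 0)
    linarith

lemma exists_mem_subdiff0_of_pos (hproper : ∀ x, g x ≠ ⊥) {φ : StrongDual ℝ X} {s : ℝ}
    (hs : 0 < s) (h : ∀ (x : X) (r : ℝ), g x ≤ r → φ x ≤ s * r) :
    StrongDual.toWeakDual (s⁻¹ • φ) ∈ subdiff0 g :=
  (mem_subdiff0_iff hproper).2 fun x r hr => (inv_mul_le_iff₀ hs).2 (h x r hr)

lemma subdiff0_nonempty (hsub : SublinearFn g) (hproper : ∀ x, g x ≠ ⊥)
    (hlsc : LowerSemicontinuous g) : (subdiff0 g).Nonempty := by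
  obtain ⟨φ, s, -, h, h0⟩ := hsub.exists_separation hlsc (x₀ := 0) (r₀ := -1)
    (by rw [hsub.1]; exact EReal.coe_neg'.2 (by norm_num))
  exact ⟨_, exists_mem_subdiff0_of_pos hproper (by simpa using h0) h⟩

/-- A lower semicontinuous sublinear function is the support function of its subdifferential. -/
lemma le_of_forall_subdiff0_le (hsub : SublinearFn g) (hproper : ∀ x, g x ≠ ⊥)
    (hlsc : LowerSemicontinuous g) {x : X} {r : ℝ} (h : ∀ c ∈ subdiff0 g, c x ≤ r) :
    g x ≤ r := by
  by_contra! hlt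
  obtain ⟨φ, s, hs, hφ, hx⟩ := hsub.exists_separation hlsc hlt
  rcases hs.eq_or_lt with rfl | hs
  · obtain ⟨c, hc⟩ := hsub.subdiff0_nonempty hproper hlsc
    rw [zero_mul] at hx
    have hmem : ∀ t : ℝ, 0 ≤ t → c + t • StrongDual.toWeakDual φ ∈ subdiff0 g := fun t ht =>
      (mem_subdiff0_iff hproper).2 fun y ρ hy => by
        change c y + t * φ y ≤ ρ
        have h1 := (mem_subdiff0_iff hproper).1 hc y ρ hy
        have h2 := hφ y ρ hy
        rw [zero_mul] at h2
        linarith [mul_nonpos_of_nonneg_of_nonpos ht h2]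
    have h1 : c x + (r - c x + 1) / φ x * φ x ≤ r :=
      h _ (hmem ((r - c x + 1) / φ x) (div_nonneg (by linarith [h c hc]) hx.le))
    rw [div_mul_cancel₀ _ hx.ne'] at h1
    linarith
  · have h1 : s⁻¹ * φ x ≤ r := h _ (exists_mem_subdiff0_of_pos hproper hs hφ)
    rw [inv_mul_le_iff₀ hs] at h1
    linarith

end SublinearFn

end Sublinear

theorem stmt8 [NormedAddCommGroup X] [NormedSpace ℝ X] [TopologicalSpace.SeparableSpace X]
    (g : X → EReal) (hsub : SublinearFn g) (hproper : ∀ x, g x ≠ ⊥)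
    (hlsc : LowerSemicontinuous g) :
    (qri (subdiff0 g)).Nonempty ∧
    ∃ xs : WeakDual ℝ X, ∃ S : Submodule ℝ X,
      {x : X | g x ≤ (xs x : EReal)} = (S : Set X) := by
  obtain ⟨a, ha, h⟩ :=
    exists_forall_le_imp_eq (isClosed_subdiff0 g) (hsub.subdiff0_nonempty hproper hlsc)
  have haC : a ∈ subdiff0 g := (mem_subdiff0_iff hproper).2 fun x r hr =>
    ha x r fun c hc => (mem_subdiff0_iff hproper).1 hc x r hr
  refine ⟨⟨a, mem_qri_of_forall_le_imp_eq (convex_subdiff0 hproper) haC h⟩, a, ?_⟩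
  have hneg : ∀ x, g x ≤ a x → g (-x) ≤ a (-x) := fun x hx =>
    hsub.le_of_forall_subdiff0_le hproper hlsc fun c hc => by
      rw [map_neg, map_neg,
        h x (fun b hb => (mem_subdiff0_iff hproper).1 hb x _ hx) c hc]
  refine ⟨{ carrier := {x | g x ≤ a x}
            add_mem' := fun {x y} hx hy => ?_
            zero_mem' := ?_
            smul_mem' := fun t x hx => ?_ }, rfl⟩
  · change g (x + y) ≤ a (x + y)
    rw [map_add]
    exact hsub.add_le hx hy
  · simp [hsub.1]
  · have key : ∀ (t : ℝ) (x : X), 0 ≤ t → g x ≤ a x → g (t • x) ≤ a (t • x) := fun t x ht hx => by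
      rw [map_smul]
      exact hsub.smul_le ht hx
    rcases le_total 0 t with ht | ht
    · exact key t x ht hx
    · have h1 := key (-t) (-x) (neg_nonneg.2 ht) (hneg x hx)
      rwa [neg_smul_neg] at h1
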